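/- Let L > 0 and 4π²/L² < c₁ < c₂. If η₁ ∈ (2c₁/√3, 2c₁) and η₂ ∈ (2c₂/√3, 2c₂) satisfy G(η₁, c₁) = L and G(η₂, c₂) = L, then η₁ < η₂. In other words, the map Γ : c ↦ η(c) selecting the amplitude of the L-periodic wave of speed c is strictly increasing. -/

import Mathlib

open Real

/-- r(η,c) = 16c²η² − 3η⁴. -/
noncomputable def rfun (η c : ℝ) : ℝ := 16 * c ^ 2 * η ^ 2 - 3 * η ^ 4

/-- The elliptic modulus κ(η,c) = √((3η² − 8c² + √r)/(2√r)). -/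
noncomputable def kfun (η c : ℝ) : ℝ :=
  Real.sqrt ((3 * η ^ 2 - 8 * c ^ 2 + Real.sqrt (rfun η c)) / (2 * Real.sqrt (rfun η c)))

/-- The complete elliptic integral of the first kind. -/
noncomputable def Kell (m : ℝ) : ℝ :=
  ∫ θ in (0:ℝ)..(Real.pi / 2), 1 / Real.sqrt (1 - m ^ 2 * Real.sin θ ^ 2)

/-- The fundamental period G(η,c) = 8√c·K(κ(η,c))/r(η,c)^{1/4} of the traveling wave. -/
noncomputable def Gfun (η c : ℝ) : ℝ :=
  8 * Real.sqrt c * Kell (kfun η c) / (rfun η c) ^ ((1 : ℝ) / 4)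

theorem one_sub_mul_sin_sq_pos {m : ℝ} (hm : m < 1) (θ : ℝ) : 0 < 1 - m * sin θ ^ 2 := by
  have h0 := sq_nonneg (sin θ)
  have h1 := sin_sq_le_one θ
  rcases le_or_gt m 0 with h | h <;> nlinarith

theorem continuous_sqrt_one_sub_mul_sin_sq (m : ℝ) :
    Continuous fun θ : ℝ => √(1 - m * sin θ ^ 2) := by
  fun_prop

/-- The complete elliptic integral of the first kind as a function of the parameter `m = k²`. -/
noncomputable def ellipticK (m : ℝ) : ℝ :=
  ∫ θ in (0 : ℝ)..(π / 2), 1 / √(1 - m * sin θ ^ 2)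

theorem Kell_sqrt {m : ℝ} (hm : 0 ≤ m) : Kell √m = ellipticK m := by
  simp only [Kell, ellipticK, sq_sqrt hm]

theorem ellipticK_pos {m : ℝ} (hm : m < 1) : 0 < ellipticK m := by
  have hpos (θ : ℝ) : 0 < √(1 - m * sin θ ^ 2) := sqrt_pos.2 (one_sub_mul_sin_sq_pos hm θ)
  refine intervalIntegral.intervalIntegral_pos_of_pos ?_ (fun θ => one_div_pos.2 (hpos θ))
    (by positivity)
  exact (continuous_const.div (continuous_sqrt_one_sub_mul_sin_sq m)
    fun θ => (hpos θ).ne').intervalIntegrable _ _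

theorem hasDerivAt_one_div_sqrt_one_sub_mul {m s : ℝ} (h : 0 < 1 - m * s) :
    HasDerivAt (fun m : ℝ => 1 / √(1 - m * s)) (s / (2 * √(1 - m * s) ^ 3)) m := by
  have hq : 0 < √(1 - m * s) := sqrt_pos.2 h
  have h1 : HasDerivAt (fun m : ℝ => 1 - m * s) (-s) m := by
    simpa using ((hasDerivAt_id m).mul_const s).const_sub 1
  simp only [one_div]
  refine ((h1.sqrt h.ne').fun_inv hq.ne').congr_deriv ?_
  field_simp

theorem hasDerivAt_ellipticK {m : ℝ} (hm : m < 1) :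
    HasDerivAt ellipticK
      (∫ θ in (0 : ℝ)..(π / 2), sin θ ^ 2 / (2 * √(1 - m * sin θ ^ 2) ^ 3)) m := by
  obtain ⟨b, hmb, hb⟩ := exists_between hm
  have hpos {x : ℝ} (hx : x < 1) (θ : ℝ) : 0 < √(1 - x * sin θ ^ 2) :=
    sqrt_pos.2 (one_sub_mul_sin_sq_pos hx θ)
  have hcont {x : ℝ} (hx : x < 1) : Continuous fun θ : ℝ => 1 / √(1 - x * sin θ ^ 2) :=
    continuous_const.div (continuous_sqrt_one_sub_mul_sin_sq x) fun θ => (hpos hx θ).ne'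
  have hcont' {x : ℝ} (hx : x < 1) :
      Continuous fun θ : ℝ => sin θ ^ 2 / (2 * √(1 - x * sin θ ^ 2) ^ 3) :=
    (by fun_prop : Continuous fun θ : ℝ => sin θ ^ 2).div
      (by fun_prop) fun θ => by have := hpos hx θ; positivity
  refine (intervalIntegral.hasDerivAt_integral_of_dominated_loc_of_deriv_le
    (μ := MeasureTheory.volume) (a := 0) (b := π / 2)
    (F := fun x θ => 1 / √(1 - x * sin θ ^ 2))
    (F' := fun x θ => sin θ ^ 2 / (2 * √(1 - x * sin θ ^ 2) ^ 3))
    (bound := fun θ => sin θ ^ 2 / (2 * √(1 - b * sin θ ^ 2) ^ 3))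
    (Iio_mem_nhds hmb) ?_ ((hcont hm).intervalIntegrable _ _)
    (hcont' hm).aestronglyMeasurable ?_ ((hcont' hb).intervalIntegrable _ _) ?_).2
  · filter_upwards [Iio_mem_nhds hm] with x hx
    exact (hcont hx).aestronglyMeasurable
  · refine Filter.Eventually.of_forall fun θ _ x hx => ?_
    have hx' : x < b := hx
    have h1 := hpos hb θ
    have h2 := hpos (hx'.trans hb) θ
    rw [norm_of_nonneg (by positivity)]
    gcongr
  · exact Filter.Eventually.of_forall fun θ _ x hx =>
      hasDerivAt_one_div_sqrt_one_sub_mul (one_sub_mul_sin_sq_pos (lt_trans hx hb) θ)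

theorem hasDerivAt_sin_mul_cos_div_sqrt {m : ℝ} (hm : m < 1) (θ : ℝ) :
    HasDerivAt (fun θ : ℝ => sin θ * cos θ / √(1 - m * sin θ ^ 2))
      ((1 - 2 * sin θ ^ 2 + m * (sin θ ^ 2) ^ 2) / √(1 - m * sin θ ^ 2) ^ 3) θ := by
  have h := one_sub_mul_sin_sq_pos hm θ
  have hq := sqrt_pos.2 h
  have h1 : HasDerivAt (fun θ : ℝ => 1 - m * sin θ ^ 2) (-(m * (2 * sin θ * cos θ))) θ := by
    simpa using (((hasDerivAt_sin θ).pow 2).const_mul m).const_sub 1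
  refine (((hasDerivAt_sin θ).fun_mul (hasDerivAt_cos θ)).fun_div
    (h1.sqrt h.ne') hq.ne').congr_deriv ?_
  have hsq := sq_sqrt h.le
  have hc : cos θ ^ 2 = 1 - sin θ ^ 2 := cos_sq' θ
  generalize √(1 - m * sin θ ^ 2) = q at *
  field_simp
  rw [hsq, hc]
  ring

theorem ellipticK_deriv_inequality {m : ℝ} (hm0 : 0 ≤ m) (hm : m < 1) :
    (1 - 2 * m) * ellipticK m ≤ 4 * (1 - m + m ^ 2) *
      ∫ θ in (0 : ℝ)..(π / 2), sin θ ^ 2 / (2 * √(1 - m * sin θ ^ 2) ^ 3) := by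
  have hpos (θ : ℝ) : 0 < √(1 - m * sin θ ^ 2) := sqrt_pos.2 (one_sub_mul_sin_sq_pos hm θ)
  have hA : Continuous fun θ : ℝ => 1 / √(1 - m * sin θ ^ 2) :=
    continuous_const.div (continuous_sqrt_one_sub_mul_sin_sq m) fun θ => (hpos θ).ne'
  have hB : Continuous fun θ : ℝ => sin θ ^ 2 / (2 * √(1 - m * sin θ ^ 2) ^ 3) :=
    (by fun_prop : Continuous fun θ : ℝ => sin θ ^ 2).div
      (by fun_prop) fun θ => by have := hpos θ; positivity
  have hC : Continuous fun θ : ℝ =>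
      (1 - 2 * sin θ ^ 2 + m * (sin θ ^ 2) ^ 2) / √(1 - m * sin θ ^ 2) ^ 3 :=
    (by fun_prop : Continuous fun θ : ℝ => 1 - 2 * sin θ ^ 2 + m * (sin θ ^ 2) ^ 2).div
      (by fun_prop) fun θ => by have := hpos θ; positivity
  have hzero : ∫ θ in (0 : ℝ)..(π / 2),
      (1 - 2 * sin θ ^ 2 + m * (sin θ ^ 2) ^ 2) / √(1 - m * sin θ ^ 2) ^ 3 = 0 := by
    rw [intervalIntegral.integral_eq_sub_of_hasDerivAt
      (fun θ _ => hasDerivAt_sin_mul_cos_div_sqrt hm θ) (hC.intervalIntegrable _ _)]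
    simp
  have hB' := hB.const_mul (4 * (1 - m + m ^ 2))
  rw [ellipticK, ← intervalIntegral.integral_const_mul, ← intervalIntegral.integral_const_mul]
  refine le_of_le_of_eq ?_ ((intervalIntegral.integral_add (hB'.intervalIntegrable _ _)
    (hC.intervalIntegrable _ _)).trans (add_eq_left.2 hzero))
  refine intervalIntegral.integral_mono_on (by positivity)
    ((hA.const_mul _).intervalIntegrable _ _)
    ((hB'.add hC).intervalIntegrable _ _) fun θ _ => ?_
  have hq := hpos θ
  have hsq := sq_sqrt (one_sub_mul_sin_sq_pos hm θ).le
  generalize √(1 - m * sin θ ^ 2) = q at *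
  have key : 4 * (1 - m + m ^ 2) * (sin θ ^ 2 / (2 * q ^ 3)) +
      (1 - 2 * sin θ ^ 2 + m * (sin θ ^ 2) ^ 2) / q ^ 3 - (1 - 2 * m) * (1 / q) =
      m * (2 - sin θ ^ 2 + (sin θ ^ 2) ^ 2) / q ^ 3 := by
    field_simp
    rw [hsq]
    ring
  have h1 := sin_sq_le_one θ
  have : 0 ≤ m * (2 - sin θ ^ 2 + (sin θ ^ 2) ^ 2) / q ^ 3 := by
    have : 0 ≤ 2 - sin θ ^ 2 + (sin θ ^ 2) ^ 2 := by nlinarith [sq_nonneg (sin θ ^ 2)]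
    positivity
  linarith

theorem monotoneOn_ellipticK_pow_four_mul :
    MonotoneOn (fun m => ellipticK m ^ 4 * (1 - m + m ^ 2)) (Set.Ico 0 1) := by
  have hd {m : ℝ} (hm : m < 1) := ((hasDerivAt_ellipticK hm).pow 4).mul
    (((hasDerivAt_id m).const_sub 1).add ((hasDerivAt_id m).pow 2))
  refine monotoneOn_of_hasDerivWithinAt_nonneg (convex_Ico 0 1)
    (fun m hm => (hd hm.2).continuousAt.continuousWithinAt)
    (fun m hm => (hd (interior_subset hm).2).hasDerivWithinAt) fun m hm => ?_
  have hm' := interior_subset hm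
  have hK := ellipticK_pos hm'.2
  have hineq := ellipticK_deriv_inequality hm'.1 hm'.2
  set D := ∫ θ in (0 : ℝ)..(π / 2), sin θ ^ 2 / (2 * √(1 - m * sin θ ^ 2) ^ 3)
  have := mul_nonneg (pow_pos hK 3).le (sub_nonneg.2 hineq)
  simp
  linarith

theorem Gfun_pow_four_mul_sq {η c : ℝ} (hc : 0 < c)
    (hη : η ∈ Set.Ioo (2 * c / √3) (2 * c)) :
    ∃ m ∈ Set.Ico (0 : ℝ) 1, ∃ q > 0,
      3 * q ^ 2 + (3 * (η / c) ^ 2 - 8) ^ 2 = 64 ∧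
      (2 * m - 1) * q = 3 * (η / c) ^ 2 - 8 ∧
      Gfun η c ^ 4 * c ^ 2 = 256 * (ellipticK m ^ 4 * (1 - m + m ^ 2)) := by
  have hη0 : 0 < η := lt_trans (by positivity) hη.1
  have h3 : 4 * c ^ 2 < 3 * η ^ 2 := by
    have h := (div_lt_iff₀ (by positivity)).1 hη.1
    have h' := pow_lt_pow_left₀ h (by positivity) two_ne_zero
    rw [mul_pow, mul_pow, sq_sqrt (by norm_num)] at h'
    linarith
  have h4 : η ^ 2 < 4 * c ^ 2 := by nlinarith [hη.2]
  have hr : 0 < rfun η c := by unfold rfun; nlinarith [sq_pos_of_pos hη0]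
  have hY : (3 * η ^ 2 - 8 * c ^ 2) ^ 2 < rfun η c := by unfold rfun; nlinarith
  have hQ := sqrt_pos.2 hr
  have hQ2 := sq_sqrt hr.le
  have habs := abs_lt.1 (lt_sqrt_of_sq_lt ((sq_abs _).trans_lt hY))
  have hm0 : 0 ≤ (3 * η ^ 2 - 8 * c ^ 2 + √(rfun η c)) / (2 * √(rfun η c)) :=
    div_nonneg (by linarith) (by positivity)
  have hm1 : (3 * η ^ 2 - 8 * c ^ 2 + √(rfun η c)) / (2 * √(rfun η c)) < 1 := by
    rw [div_lt_one (by positivity)]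
    linarith
  have hroot : ((rfun η c) ^ ((1 : ℝ) / 4)) ^ 4 = rfun η c := by
    rw [← rpow_natCast, ← rpow_mul hr.le]
    norm_num
  have hcs : √c ^ 4 = c ^ 2 := by
    rw [show √c ^ 4 = (√c ^ 2) ^ 2 by ring, sq_sqrt hc.le]
  refine ⟨_, ⟨hm0, hm1⟩, √(rfun η c) / c ^ 2, by positivity, ?_, ?_, ?_⟩
  · rw [div_pow, hQ2, rfun]
    field_simp
    ring
  · field_simp
    ring
  · rw [Gfun, kfun, Kell_sqrt hm0, div_pow, mul_pow, mul_pow, hroot, hcs]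
    generalize ellipticK _ = K
    have hp : 1 - (3 * η ^ 2 - 8 * c ^ 2 + √(rfun η c)) / (2 * √(rfun η c)) +
        ((3 * η ^ 2 - 8 * c ^ 2 + √(rfun η c)) / (2 * √(rfun η c))) ^ 2 =
        16 * c ^ 4 / √(rfun η c) ^ 2 := by
      have hQ3 : √(rfun η c) ^ 2 = 16 * c ^ 2 * η ^ 2 - 3 * η ^ 4 := by rw [hQ2, rfun]
      generalize √(rfun η c) = Q at *
      field_simp
      linear_combination 3 * hQ3
    rw [hp, hQ2]
    field_simp
    ring

theorem mul_le_mul_of_three_mul_sq_add_sq {p q x y : ℝ} (hp : 0 < p) (hq : 0 < q)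
    (hpx : 3 * p ^ 2 + x ^ 2 = 64) (hqy : 3 * q ^ 2 + y ^ 2 = 64) (hxy : x ≤ y) :
    x * q ≤ y * p := by
  rcases le_or_gt 0 x with hx | hx
  · have : q ≤ p := by nlinarith
    exact mul_le_mul hxy this hq.le (hx.trans hxy)
  rcases le_or_gt 0 y with hy | hy
  · nlinarith [mul_nonneg hy hp.le, mul_pos (neg_pos.2 hx) hq]
  · have : p ≤ q := by nlinarith
    nlinarith

/-- Along the family of L-periodic DSW waves, the amplitude η(c) is a strictly
increasing function of the wave speed c. -/
theorem dsw_amplitude_increasing_in_speed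
    (L c₁ c₂ η₁ η₂ : ℝ) (hL : 0 < L)
    (hc₁ : 4 * Real.pi ^ 2 / L ^ 2 < c₁) (hc₁₂ : c₁ < c₂)
    (hη₁ : η₁ ∈ Set.Ioo (2 * c₁ / Real.sqrt 3) (2 * c₁))
    (hη₂ : η₂ ∈ Set.Ioo (2 * c₂ / Real.sqrt 3) (2 * c₂))
    (hG₁ : Gfun η₁ c₁ = L) (hG₂ : Gfun η₂ c₂ = L) :
    η₁ < η₂ := by
  have hc₁0 : 0 < c₁ := lt_of_le_of_lt (by positivity) hc₁
  have hc₂0 : 0 < c₂ := hc₁0.trans hc₁₂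
  obtain ⟨m₁, hm₁, q₁, hq₁, he₁, hu₁, hF₁⟩ := Gfun_pow_four_mul_sq hc₁0 hη₁
  obtain ⟨m₂, hm₂, q₂, hq₂, he₂, hu₂, hF₂⟩ := Gfun_pow_four_mul_sq hc₂0 hη₂
  have hη₂0 : 0 < η₂ := lt_trans (by positivity) hη₂.1
  rw [hG₁] at hF₁
  rw [hG₂] at hF₂
  have hm : m₁ < m₂ := by
    by_contra! h
    have hmono := monotoneOn_ellipticK_pow_four_mul hm₂ hm₁ h
    have : L ^ 4 * c₁ ^ 2 < L ^ 4 * c₂ ^ 2 := by gcongr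
    dsimp only at hmono
    linarith
  by_contra! h
  have hη₁0 : 0 < η₁ := hη₂0.trans_le h
  have hs : η₂ / c₂ ≤ η₁ / c₁ := by gcongr
  have hs2 : 3 * (η₂ / c₂) ^ 2 - 8 ≤ 3 * (η₁ / c₁) ^ 2 - 8 := by gcongr
  have hle := mul_le_mul_of_three_mul_sq_add_sq hq₂ hq₁ he₂ he₁ hs2
  rw [← hu₁, ← hu₂] at hle
  nlinarith [mul_pos (mul_pos hq₁ hq₂) (sub_pos.2 hm)]
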